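/- For each k ∈ ℕ, the class of k-polymatroidal binary functions is closed under taking minors: if f on ground set E is k-polymatroidal and e ∈ E, then both f/e and f∖e are well defined and k-polymatroidal. -/

import Mathlib

/-- A binary function on finite ground set `E`: a function `f : 2^E → ℝ` with `f ∅ = 1`.
(The function is defined on all finite sets; only its values on subsets of `E` matter.) -/
structure BinaryFunction (α : Type) [DecidableEq α] where
  E : Finset α
  f : Finset α → ℝ
  empty_one : f ∅ = 1

namespace BinaryFunction

variable {α : Type} [DecidableEq α]

/-- Contraction of a single element: `(f/e)(Y) = f(Y)` on ground set `E ∖ {e}`. -/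
def contract (g : BinaryFunction α) (e : α) : BinaryFunction α :=
  ⟨g.E.erase e, g.f, g.empty_one⟩

/-- Deletion of a single element: `(f∖e)(Y) = (f(Y) + f(Y ∪ {e})) / (1 + f({e}))`
on ground set `E ∖ {e}`; well defined iff `1 + f({e}) ≠ 0` (in which case the
`if` branch below agrees with the formula, since the formula gives `1` at `∅`). -/
noncomputable def delete (g : BinaryFunction α) (e : α) : BinaryFunction α :=
  ⟨g.E.erase e,
   fun Y => if Y = ∅ then 1 else (g.f Y + g.f (Y ∪ {e})) / (1 + g.f {e}),
   by simp⟩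

/-- Contraction of a set: `(f/X)(Y) = f(Y)` on ground set `E ∖ X`. -/
def contractSet (g : BinaryFunction α) (X : Finset α) : BinaryFunction α :=
  ⟨g.E \ X, g.f, g.empty_one⟩

/-- Deletion of a set: `(f∖X)(Y) = (∑_{Z ⊆ X} f(Y ∪ Z)) / (∑_{Z ⊆ X} f(Z))`
on ground set `E ∖ X`; well defined iff `∑_{Z ⊆ X} f(Z) ≠ 0` (in which case the
`if` branch agrees with the formula, since the formula gives `1` at `∅`). -/
noncomputable def deleteSet (g : BinaryFunction α) (X : Finset α) : BinaryFunction α :=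
  ⟨g.E \ X,
   fun Y => if Y = ∅ then 1 else
     (∑ Z ∈ X.powerset, g.f (Y ∪ Z)) / (∑ Z ∈ X.powerset, g.f Z),
   by simp⟩

/-- `IsMinorOf m f`: `m` is obtained from `f` by a sequence of single-element
contractions and deletions, each step being well defined. -/
inductive IsMinorOf : BinaryFunction α → BinaryFunction α → Prop
  | refl (f : BinaryFunction α) : IsMinorOf f f
  | contract {f g : BinaryFunction α} (e : α) (he : e ∈ g.E)
      (h : IsMinorOf g f) : IsMinorOf (g.contract e) f
  | delete {f g : BinaryFunction α} (e : α) (he : e ∈ g.E)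
      (hw : 1 + g.f {e} ≠ 0) (h : IsMinorOf g f) : IsMinorOf (g.delete e) f

/-- `f` is stable: every sequence of single-element contractions and deletions applied
to `f` is well defined at every step, i.e. at every reachable minor `g`, deletion of any
ground-set element is well defined. -/
def Stable (f : BinaryFunction α) : Prop :=
  ∀ g : BinaryFunction α, IsMinorOf g f → ∀ e ∈ g.E, 1 + g.f {e} ≠ 0

/-- Isomorphism of binary functions: a bijection `φ` of ground sets with
`f(X) = f'(φ(X))` for all `X ⊆ E`. -/
def Isomorphic (g g' : BinaryFunction α) : Prop :=
  ∃ φ : α → α, Set.InjOn φ ↑g.E ∧ g.E.image φ = g'.E ∧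
    ∀ X ⊆ g.E, g.f X = g'.f (X.image φ)

/-- `f_α`: the order-one binary function on ground set `{e}` with value `α` on `{e}`. -/
def fAlpha (e : α) (a : ℝ) : BinaryFunction α :=
  ⟨{e}, fun X => if X = ∅ then 1 else a, by simp⟩

/-- The rank function `Qf(X) = log₂((∑_{Y ⊆ E} f(Y)) / (∑_{Y ⊆ E∖X} f(Y)))`. -/
noncomputable def Q (g : BinaryFunction α) (X : Finset α) : ℝ :=
  Real.logb 2 ((∑ Y ∈ g.E.powerset, g.f Y) / (∑ Y ∈ (g.E \ X).powerset, g.f Y))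

/-- `f` is rankable: for every `X ⊆ E` the denominator in `Qf(X)` is nonzero and
the quotient is strictly positive. -/
def Rankable (g : BinaryFunction α) : Prop :=
  ∀ X ⊆ g.E, (∑ Y ∈ (g.E \ X).powerset, g.f Y) ≠ 0 ∧
    0 < (∑ Y ∈ g.E.powerset, g.f Y) / (∑ Y ∈ (g.E \ X).powerset, g.f Y)

/-- `f` is `k`-polymatroidal: rankable, with `Qf` satisfying R0–R3. -/
def Polymatroidal (k : ℕ) (g : BinaryFunction α) : Prop :=
  Rankable g ∧
  (∀ X ⊆ g.E, ∃ n : ℕ, g.Q X = n) ∧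
  (∀ X ⊆ g.E, g.Q X ≤ (k : ℝ) * X.card) ∧
  (∀ X ⊆ g.E, ∀ e ∈ g.E, e ∉ X → g.Q X ≤ g.Q (insert e X)) ∧
  (∀ X ⊆ g.E, ∀ a ∈ g.E, ∀ b ∈ g.E, a ∉ X → b ∉ X → a ≠ b →
    g.Q X + g.Q (insert a (insert b X)) ≤ g.Q (insert a X) + g.Q (insert b X))

/-- `f` is linear: `{0,1}`-valued on subsets of `E`, and closed under symmetric
difference of supports. -/
def Linear (g : BinaryFunction α) : Prop :=
  (∀ X ⊆ g.E, g.f X = 0 ∨ g.f X = 1) ∧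
  (∀ X ⊆ g.E, ∀ Y ⊆ g.E, g.f X = 1 → g.f Y = 1 → g.f (symmDiff X Y) = 1)

/-- The order-two excluded minor `g`: value `1` on sets of size `0,1`, `-1` on size `2`. -/
def gTwo (a b : α) : BinaryFunction α :=
  ⟨{a, b}, fun X => if X.card = 2 then -1 else 1, by simp⟩

/-- The order-four excluded minor `f_{U_{2,4}}`: `1` on sizes `0,3`, `0` on sizes `1,2`,
`-1` on size `4`. -/
def fU24 (a b c d : α) : BinaryFunction α :=
  ⟨{a, b, c, d},
   fun X => if X.card = 0 then 1 else if X.card ≤ 2 then 0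
            else if X.card = 3 then 1 else -1,
   by simp⟩

/-- The order-two excluded minors `f_{α,β,γ}` of the `k`-polymatroidal binary functions. -/
def fABG (a b : α) (p q r : ℕ) : BinaryFunction α :=
  ⟨{a, b},
   fun X =>
     if X = ∅ then 1
     else if X = {a} then 2 ^ (p + r - q + 1) - 1
     else if X = {b} then 2 ^ (r + 1) - 1
     else 2 ^ (p + r + 1) - 2 ^ (r + 1) - 2 ^ (p + r - q + 1) + 1,
   by simp⟩

end BinaryFunction
namespace BinaryFunction

variable {α : Type} [DecidableEq α]

/-- The sum of the values of `g` over all subsets of `W`. -/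
noncomputable def subsetSum (g : BinaryFunction α) (W : Finset α) : ℝ :=
  ∑ Y ∈ W.powerset, g.f Y

lemma subsetSum_empty (g : BinaryFunction α) : g.subsetSum ∅ = 1 := by
  simp [subsetSum, g.empty_one]

lemma subsetSum_singleton (g : BinaryFunction α) (e : α) :
    g.subsetSum {e} = 1 + g.f {e} := by
  rw [subsetSum, ← insert_empty_eq e, Finset.sum_powerset_insert (Finset.notMem_empty e)]
  simp [g.empty_one]

/-- When deletion is well defined, its defining formula holds at every set, including `∅`. -/
lemma delete_f_apply (g : BinaryFunction α) {e : α} (h : 1 + g.f {e} ≠ 0) (Y : Finset α) :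
    (g.delete e).f Y = (g.f Y + g.f (insert e Y)) / (1 + g.f {e}) := by
  by_cases hY : Y = ∅
  · subst hY
    simp [delete, g.empty_one, h]
  · simp [delete, hY]

lemma subsetSum_delete (g : BinaryFunction α) {e : α} (h : 1 + g.f {e} ≠ 0)
    {W : Finset α} (heW : e ∉ W) :
    (g.delete e).subsetSum W = g.subsetSum (insert e W) / (1 + g.f {e}) := by
  simp only [subsetSum, g.delete_f_apply h]
  rw [← Finset.sum_div, Finset.sum_add_distrib, Finset.sum_powerset_insert heW]

lemma Q_eq_logb_subsetSum (g : BinaryFunction α) (X : Finset α) :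
    g.Q X = Real.logb 2 (g.subsetSum g.E / g.subsetSum (g.E \ X)) := rfl

/-- Rankability says exactly that all subset sums are positive, because the empty one is `1`. -/
lemma rankable_iff_subsetSum_pos (g : BinaryFunction α) :
    g.Rankable ↔ ∀ W ⊆ g.E, 0 < g.subsetSum W := by
  constructor
  · intro h W hW
    have hE : 0 < g.subsetSum g.E := by
      have hpos := (h g.E subset_rfl).2
      rw [Finset.sdiff_self] at hpos
      change 0 < g.subsetSum g.E / g.subsetSum ∅ at hpos
      rwa [subsetSum_empty, div_one] at hpos
    have hpos := (h (g.E \ W) Finset.sdiff_subset).2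
    rw [Finset.sdiff_sdiff_eq_self hW] at hpos
    exact (div_pos_iff_of_pos_left hE).1 hpos
  · intro h X _
    have hX := h (g.E \ X) Finset.sdiff_subset
    exact ⟨hX.ne', div_pos (h g.E subset_rfl) hX⟩

lemma Rankable.subsetSum_pos {g : BinaryFunction α} (h : g.Rankable) {W : Finset α}
    (hW : W ⊆ g.E) : 0 < g.subsetSum W :=
  g.rankable_iff_subsetSum_pos.1 h W hW

lemma Rankable.Q_eq_sub {g : BinaryFunction α} (h : g.Rankable) (X : Finset α) :
    g.Q X = Real.logb 2 (g.subsetSum g.E) - Real.logb 2 (g.subsetSum (g.E \ X)) := by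
  rw [Q_eq_logb_subsetSum, Real.logb_div (h.subsetSum_pos subset_rfl).ne'
    (h.subsetSum_pos Finset.sdiff_subset).ne']

lemma Rankable.Q_empty {g : BinaryFunction α} (h : g.Rankable) : g.Q ∅ = 0 := by
  simp [h.Q_eq_sub]

lemma Rankable.one_add_ne_zero {g : BinaryFunction α} (h : g.Rankable) {e : α} (he : e ∈ g.E) :
    1 + g.f {e} ≠ 0 := by
  rw [← subsetSum_singleton]
  exact (h.subsetSum_pos (Finset.singleton_subset_iff.2 he)).ne'

lemma Rankable.contract {g : BinaryFunction α} (h : g.Rankable) (e : α) :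
    (g.contract e).Rankable :=
  (rankable_iff_subsetSum_pos _).2 fun _ hW =>
    h.subsetSum_pos (hW.trans (Finset.erase_subset e g.E))

lemma Rankable.delete {g : BinaryFunction α} (h : g.Rankable) {e : α} (he : e ∈ g.E) :
    (g.delete e).Rankable := by
  refine (rankable_iff_subsetSum_pos _).2 fun W hW => ?_
  have hW' := Finset.subset_erase.1 hW
  rw [g.subsetSum_delete (h.one_add_ne_zero he) hW'.2, ← subsetSum_singleton]
  exact div_pos (h.subsetSum_pos (Finset.insert_subset he hW'.1))
    (h.subsetSum_pos (Finset.singleton_subset_iff.2 he))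

lemma Rankable.Q_contract {g : BinaryFunction α} (h : g.Rankable) (e : α) (X : Finset α) :
    (g.contract e).Q X = g.Q (insert e X) - g.Q {e} := by
  have hX : g.E.erase e \ X = g.E \ insert e X := by grind
  rw [(h.contract e).Q_eq_sub, h.Q_eq_sub, h.Q_eq_sub, Finset.sdiff_singleton_eq_erase, ← hX]
  change Real.logb 2 (g.subsetSum (g.E.erase e)) -
    Real.logb 2 (g.subsetSum (g.E.erase e \ X)) = _
  ring

lemma Rankable.Q_delete {g : BinaryFunction α} (h : g.Rankable) {e : α} (he : e ∈ g.E)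
    {X : Finset α} (heX : e ∉ X) : (g.delete e).Q X = g.Q X := by
  have hne := h.one_add_ne_zero he
  have hX : insert e (g.E.erase e \ X) = g.E \ X := by grind
  rw [Q_eq_logb_subsetSum, Q_eq_logb_subsetSum]
  change Real.logb 2 ((g.delete e).subsetSum (g.E.erase e) /
    (g.delete e).subsetSum (g.E.erase e \ X)) = _
  rw [g.subsetSum_delete hne (Finset.notMem_erase e g.E),
    g.subsetSum_delete hne (by simp), Finset.insert_erase he, hX,
    div_div_div_cancel_right₀ hne]

lemma Polymatroidal.Q_singleton_le_Q_insert {k : ℕ} {g : BinaryFunction α}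
    (h : g.Polymatroidal k) {e : α} (he : e ∈ g.E) {X : Finset α} (hX : X ⊆ g.E) :
    g.Q {e} ≤ g.Q (insert e X) := by
  induction X using Finset.induction_on with
  | empty => simp
  | insert a X _ ih =>
    obtain ⟨haE, hXE⟩ := Finset.insert_subset_iff.1 hX
    refine (ih hXE).trans ?_
    rw [Finset.insert_comm]
    by_cases ha : a ∈ insert e X
    · rw [Finset.insert_eq_of_mem ha]
    · exact h.2.2.2.1 _ (Finset.insert_subset he hXE) a haE ha

lemma Polymatroidal.Q_insert_le_add {k : ℕ} {g : BinaryFunction α}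
    (h : g.Polymatroidal k) {e : α} (he : e ∈ g.E) {X : Finset α} (hX : X ⊆ g.E)
    (heX : e ∉ X) : g.Q (insert e X) ≤ g.Q X + g.Q {e} := by
  induction X using Finset.induction_on with
  | empty => simp [h.1.Q_empty]
  | insert a X haX ih =>
    obtain ⟨haE, hXE⟩ := Finset.insert_subset_iff.1 hX
    obtain ⟨hea, heX'⟩ := not_or.1 (Finset.mem_insert.not.1 heX)
    have hsub := h.2.2.2.2 X hXE e he a haE heX' haX hea
    linarith [ih hXE heX']

lemma Polymatroidal.contract {k : ℕ} {g : BinaryFunction α} (h : g.Polymatroidal k) {e : α}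
    (he : e ∈ g.E) : (g.contract e).Polymatroidal k := by
  have hErase {X : Finset α} (hX : X ⊆ (g.contract e).E) : X ⊆ g.E ∧ e ∉ X :=
    Finset.subset_erase.1 hX
  have hMem {a : α} (ha : a ∈ (g.contract e).E) : a ≠ e ∧ a ∈ g.E := Finset.mem_erase.1 ha
  refine ⟨h.1.contract e, fun X hX => ?_, fun X hX => ?_, fun X hX a ha haX => ?_,
    fun X hX a ha b hb haX hbX hab => ?_⟩
  · obtain ⟨hXE, -⟩ := hErase hX
    obtain ⟨m, hm⟩ := h.2.1 (insert e X) (Finset.insert_subset he hXE)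
    obtain ⟨n, hn⟩ := h.2.1 {e} (Finset.singleton_subset_iff.2 he)
    have hle := h.Q_singleton_le_Q_insert he hXE
    rw [hm, hn, Nat.cast_le] at hle
    exact ⟨m - n, by rw [h.1.Q_contract, hm, hn, Nat.cast_sub hle]⟩
  · obtain ⟨hXE, heX⟩ := hErase hX
    rw [h.1.Q_contract]
    linarith [h.Q_insert_le_add he hXE heX, h.2.2.1 X hXE]
  · obtain ⟨hXE, -⟩ := hErase hX
    obtain ⟨hae, haE⟩ := hMem ha
    rw [h.1.Q_contract, h.1.Q_contract, Finset.insert_comm]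
    exact sub_le_sub_right (h.2.2.2.1 _ (Finset.insert_subset he hXE) a haE
      (by simp [hae, haX])) _
  · obtain ⟨hXE, -⟩ := hErase hX
    obtain ⟨hae, haE⟩ := hMem ha
    obtain ⟨hbe, hbE⟩ := hMem hb
    have hsub := h.2.2.2.2 (insert e X) (Finset.insert_subset he hXE) a haE b hbE
      (by simp [hae, haX]) (by simp [hbe, hbX]) hab
    simp only [h.1.Q_contract]
    rw [Finset.insert_comm e a, Finset.insert_comm e b, Finset.insert_comm e a]
    linarith

lemma Polymatroidal.delete {k : ℕ} {g : BinaryFunction α} (h : g.Polymatroidal k) {e : α}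
    (he : e ∈ g.E) : (g.delete e).Polymatroidal k := by
  have hQ {X : Finset α} (hX : X ⊆ (g.delete e).E) : (g.delete e).Q X = g.Q X :=
    h.1.Q_delete he (Finset.subset_erase.1 hX).2
  have hE : (g.delete e).E ⊆ g.E := Finset.erase_subset e g.E
  refine ⟨h.1.delete he, fun X hX => ?_, fun X hX => ?_, fun X hX a ha haX => ?_,
    fun X hX a ha b hb haX hbX hab => ?_⟩
  · rw [hQ hX]
    exact h.2.1 X (hX.trans hE)
  · rw [hQ hX]
    exact h.2.2.1 X (hX.trans hE)
  · rw [hQ hX, hQ (Finset.insert_subset ha hX)]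
    exact h.2.2.2.1 X (hX.trans hE) a (hE ha) haX
  · have hbX' := Finset.insert_subset hb hX
    rw [hQ hX, hQ (Finset.insert_subset ha hX), hQ hbX', hQ (Finset.insert_subset ha hbX')]
    exact h.2.2.2.2 X (hX.trans hE) a (hE ha) b (hE hb) haX hbX hab

end BinaryFunction

open BinaryFunction in
/-- For each `k`, the `k`-polymatroidal binary functions are minor-closed:
for `k`-polymatroidal `f` and `e ∈ E`, both `f/e` and `f∖e` are well defined and
`k`-polymatroidal. -/
theorem polymatroidal_minor_closed {α : Type} [DecidableEq α] (k : ℕ)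
    (f : BinaryFunction α) (e : α) (he : e ∈ f.E) (hf : f.Polymatroidal k) :
    (f.contract e).Polymatroidal k ∧ 1 + f.f {e} ≠ 0 ∧
      (f.delete e).Polymatroidal k := by
  exact ⟨hf.contract he, hf.1.one_add_ne_zero he, hf.delete he⟩
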